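/- Let n ≥ 1 be a natural number, s ∈ (1/2, 1], ν > −n/(2s), and let σ ∈ ℝ satisfy 0 < σ < sν + n/2. Define ũ_ν(z) := 2^z Γ(ν+(n−z)/(2s)) Γ(z/2) / Γ((n−z)/2). Then for every r > 0, the integral (1/(2π)) ∫_ℝ r^{−(2σ+λi)} · ũ_ν(2σ + λi) dλ converges absolutely and equals 2 · Σ_{j=0}^∞ (Γ(ν + n/(2s) + j/s) / (Γ(n/2 + j) · j!)) · (−r²/4)^j, where the series converges absolutely. -/

import Mathlib

open MeasureTheory

lemma aux_half (y : ℝ) : ‖Complex.Gamma ((1/2:ℝ) + y * Complex.I)‖ ^ 2 * Real.cosh (Real.pi * y)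
    = Real.pi := by
  have h := Complex.Gamma_mul_Gamma_one_sub ((1/2:ℝ) + y * Complex.I)
  have e1 : (1 : ℂ) - ((1/2:ℝ) + y * Complex.I) = (starRingEnd ℂ) ((1/2:ℝ) + y * Complex.I) := by
    simp only [map_add, map_mul, Complex.conj_ofReal, Complex.conj_I]
    push_cast; ring
  have e2 : Complex.sin (Real.pi * ((1/2:ℝ) + y * Complex.I)) = ((Real.cosh (Real.pi * y) : ℝ) : ℂ) := by
    have : (Real.pi * ((1/2:ℝ) + y * Complex.I) : ℂ) = ((Real.pi * y : ℝ) : ℂ) * Complex.I + Real.pi / 2 := by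
      push_cast; ring
    rw [this, Complex.sin_add_pi_div_two, Complex.cos_mul_I, Complex.ofReal_cosh]
  rw [e1, e2, Complex.Gamma_conj, Complex.mul_conj, Complex.normSq_eq_norm_sq] at h
  have hc : (0:ℝ) < Real.cosh (Real.pi * y) := Real.cosh_pos _
  rw [← Complex.ofReal_div] at h
  have h2 := Complex.ofReal_injective h
  rw [h2]; field_simp

lemma norm_GammaSeq (x y : ℝ) (m : ℕ) (hm : 0 < m) :
    ‖Complex.GammaSeq (x + y * Complex.I) m‖ = (m:ℝ) ^ x * m.factorial /
      ∏ j ∈ Finset.range (m+1), ‖((x + j : ℝ) : ℂ) + y * Complex.I‖ := by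
  rw [Complex.GammaSeq, norm_div, norm_mul, norm_prod]
  congr 1
  · congr 1
    · have := Complex.norm_cpow_eq_rpow_re_of_pos (x := (m:ℝ)) (by exact_mod_cast hm) (x + y * Complex.I)
      simpa using this
    · simp
  · refine Finset.prod_congr rfl fun j _ => ?_
    congr 1; push_cast; ring

lemma gamma_lower_aux (x y : ℝ) (hx : 1/2 ≤ x) :
    ‖Complex.Gamma ((x:ℝ) + (0:ℝ) * Complex.I)‖ * ‖Complex.Gamma ((1/2:ℝ) + y * Complex.I)‖ ≤
    ‖Complex.Gamma (x + y * Complex.I)‖ * ‖Complex.Gamma ((1/2:ℝ) + (0:ℝ) * Complex.I)‖ := by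
  have t := fun z : ℂ => (Complex.GammaSeq_tendsto_Gamma z).norm
  refine le_of_tendsto_of_tendsto ((t _).mul (t _)) ((t _).mul (t _)) ?_
  filter_upwards [Filter.eventually_gt_atTop 0] with m hm
  rw [norm_GammaSeq _ _ _ hm, norm_GammaSeq _ _ _ hm, norm_GammaSeq _ _ _ hm, norm_GammaSeq _ _ _ hm]
  rw [div_mul_div_comm, div_mul_div_comm]
  have hm0 : (0:ℝ) < m := by exact_mod_cast hm
  have pos : ∀ x y : ℝ, 0 < x → 0 < ∏ j ∈ Finset.range (m+1), ‖((x + j : ℝ) : ℂ) + y * Complex.I‖ := by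
    intro x y hx
    refine Finset.prod_pos fun j _ => norm_pos_iff.mpr ?_
    intro h
    have := congrArg Complex.re h
    simp at this
    have : (0:ℝ) ≤ j := by positivity
    linarith
  refine div_le_div_of_nonneg_left (by positivity) (mul_pos (pos _ _ (by linarith)) (pos _ _ (by norm_num))) ?_
  rw [← Finset.prod_mul_distrib, ← Finset.prod_mul_distrib]
  refine Finset.prod_le_prod (fun _ _ => by positivity) fun j _ => ?_
  have n2 : ∀ a b : ℝ, ‖(a : ℂ) + b * Complex.I‖ = Real.sqrt (a^2 + b^2) := fun a b => by
    rw [Complex.norm_add_mul_I]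
  rw [n2, n2, n2, n2, ← Real.sqrt_mul (by positivity), ← Real.sqrt_mul (by positivity)]
  apply Real.sqrt_le_sqrt
  have : (0:ℝ) ≤ j := by positivity
  have : (1/2 + (j:ℝ))^2 ≤ (x+j)^2 := by gcongr
  nlinarith [sq_nonneg y]

lemma gamma_lower (x y : ℝ) (hx : 1/2 ≤ x) :
    ‖(Complex.Gamma (x + y * Complex.I))⁻¹‖ ≤ Real.sqrt (Real.cosh (Real.pi * y)) / Real.Gamma x := by
  have h := gamma_lower_aux x y hx
  have h0 := aux_half 0
  have hy := aux_half y
  have hp : 0 < Real.Gamma x := Real.Gamma_pos_of_pos (by linarith)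
  have e : ‖Complex.Gamma ((x:ℝ) + (0:ℝ) * Complex.I)‖ = Real.Gamma x := by
    simp only [Complex.ofReal_zero, zero_mul, add_zero]
    rw [Complex.Gamma_ofReal, Complex.norm_real, Real.norm_of_nonneg hp.le]
  rw [e] at h
  simp only [mul_zero, Real.cosh_zero, mul_one] at h0
  set A := ‖Complex.Gamma ((1/2:ℝ) + y * Complex.I)‖
  set B := ‖Complex.Gamma ((1/2:ℝ) + (0:ℝ) * Complex.I)‖
  set D := ‖Complex.Gamma (x + y * Complex.I)‖ with hD
  have hc : (0:ℝ) < Real.cosh (Real.pi * y) := Real.cosh_pos _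
  set q := Real.sqrt (Real.cosh (Real.pi * y)) with hq
  have hq0 : 0 < q := Real.sqrt_pos.mpr hc
  have hqq : q^2 = Real.cosh (Real.pi * y) := Real.sq_sqrt hc.le
  have hB : B = A * q := by
    have : B^2 = (A*q)^2 := by rw [h0, mul_pow, hqq, hy]
    exact (sq_eq_sq₀ (norm_nonneg _) (by positivity)).mp this
  have hA : 0 < A := by
    rcases (norm_nonneg _ : 0 ≤ A).lt_or_eq with h | h
    · exact h
    · have h' : A = 0 := h.symm
      rw [h'] at hy; simp at hy; exact absurd hy.symm Real.pi_ne_zero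
  have hg : Real.Gamma x ≤ D * q := by
    rw [hB] at h
    have : Real.Gamma x * A ≤ (D * q) * A := by linarith
    exact le_of_mul_le_mul_right this hA
  have hDp : 0 < D := by
    by_contra hcon
    have : D = 0 := le_antisymm (not_lt.mp hcon) (norm_nonneg _)
    rw [this] at hg; linarith
  rw [norm_inv, ← hD, inv_eq_one_div, div_le_div_iff₀ hDp hp]
  linarith

lemma gamma_upper0 (x y : ℝ) (hx : 0 < x) : ‖Complex.Gamma (x + y * Complex.I)‖ ≤ Real.Gamma x := by
  rw [Complex.Gamma_eq_integral (by simpa using hx), Real.Gamma_eq_integral hx, Complex.GammaIntegral]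
  refine (norm_integral_le_integral_norm _).trans_eq ?_
  refine setIntegral_congr_fun measurableSet_Ioi fun t ht => ?_
  simp only [norm_mul, Complex.norm_real]
  rw [Real.norm_of_nonneg (Real.exp_pos _).le, Complex.norm_cpow_eq_rpow_re_of_pos ht]
  simp

lemma gamma_upper (K : ℕ) : ∀ (x y : ℝ) (_ : 0 < x),
    ‖Complex.Gamma (x + y * Complex.I)‖ * |y| ^ K ≤ Real.Gamma (x + K) := by
  induction K with
  | zero => intro x y hx; simpa using gamma_upper0 x y hx
  | succ K ih =>
    intro x y hx
    have h1 := ih (x+1) y (by linarith)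
    have hne : (x + y * Complex.I : ℂ) ≠ 0 := by
      intro h; have := congrArg Complex.re h; simp at this; linarith
    have e : (((x+1:ℝ) : ℂ) + y * Complex.I) = (x + y * Complex.I) + 1 := by push_cast; ring
    rw [e, Complex.Gamma_add_one _ hne, norm_mul] at h1
    have h2 : |y| ≤ ‖(x + y * Complex.I : ℂ)‖ := by
      simpa using Complex.abs_im_le_norm (x + y * Complex.I)
    have : x + 1 + (K:ℝ) = x + ((K+1 : ℕ):ℝ) := by push_cast; ring
    rw [this] at h1
    refine le_trans ?_ h1
    rw [pow_succ]
    calc _ = |y| * ‖Complex.Gamma (x + y * Complex.I)‖ * |y|^K := by ring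
      _ ≤ _ := by gcongr

lemma gamma_upper2 (x y : ℝ) (hx : 0 < x) :
    ‖Complex.Gamma (x + y * Complex.I)‖ ≤ Real.Gamma (x + 2) / (x^2 + y^2) := by
  have hne : (x + y * Complex.I : ℂ) ≠ 0 := by
    intro h; have := congrArg Complex.re h; simp at this; linarith
  have hne1 : (x + y * Complex.I : ℂ) + 1 ≠ 0 := by
    intro h; have := congrArg Complex.re h; simp at this; linarith
  have h := gamma_upper0 (x+2) y (by linarith)
  have e : (((x+2:ℝ) : ℂ) + y * Complex.I) = (x + y * Complex.I) + 1 + 1 := by push_cast; ring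
  rw [e, Complex.Gamma_add_one _ hne1, Complex.Gamma_add_one _ hne, norm_mul, norm_mul] at h
  have n2 : ∀ a b : ℝ, ‖(a : ℂ) + b * Complex.I‖ = Real.sqrt (a^2 + b^2) := fun a b => by
    rw [Complex.norm_add_mul_I]
  have h3 : ‖(x + y * Complex.I : ℂ)‖ ≤ ‖(x + y * Complex.I : ℂ) + 1‖ := by
    have : (x + y * Complex.I : ℂ) + 1 = ((x+1:ℝ) : ℂ) + y * Complex.I := by push_cast; ring
    rw [this, n2, n2]
    apply Real.sqrt_le_sqrt; nlinarith
  have hpos : 0 < x^2 + y^2 := by positivity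
  rw [le_div_iff₀ hpos]
  refine le_trans ?_ h
  have : x^2 + y^2 = ‖(x + y * Complex.I : ℂ)‖ * ‖(x + y * Complex.I : ℂ)‖ := by
    rw [n2, Real.mul_self_sqrt hpos.le]
  rw [this]
  calc _ = ‖(x + y * Complex.I : ℂ)‖ * (‖(x + y * Complex.I : ℂ)‖ * ‖Complex.Gamma (x + y * Complex.I)‖) := by ring
    _ ≤ _ := by gcongr

/-- polynomial times sqrt cosh bound for the reciprocal Gamma function on strips -/
lemma inv_gamma_strip (A B : ℝ) : ∃ C : ℝ, 0 ≤ C ∧ ∃ K : ℕ, ∀ x y : ℝ, A ≤ x → x ≤ B →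
    ‖(Complex.Gamma (x + y * Complex.I))⁻¹‖ ≤
      C * (1 + |y|) ^ K * Real.sqrt (Real.cosh (Real.pi * y)) := by
  have key : ∀ (K : ℕ) (A B : ℝ), 1/2 ≤ A + K → ∃ C : ℝ, 0 ≤ C ∧ ∀ x y : ℝ, A ≤ x → x ≤ B →
    ‖(Complex.Gamma (x + y * Complex.I))⁻¹‖ ≤
      C * (1 + |y|) ^ K * Real.sqrt (Real.cosh (Real.pi * y)) := by
    intro K
    induction K with
    | zero =>
      intro A B h
      simp only [Nat.cast_zero, add_zero] at h
      have hc : ContinuousOn (fun x => (Real.Gamma x)⁻¹) (Set.Icc A B) := by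
        intro x hx
        have hx0 : 0 < x := by have := hx.1; linarith
        refine (ContinuousAt.inv₀ ?_ (Real.Gamma_pos_of_pos hx0).ne').continuousWithinAt
        refine (Real.differentiableAt_Gamma fun m => ?_).continuousAt
        have : (0:ℝ) ≤ m := by positivity
        linarith
      obtain ⟨C, hC⟩ := isCompact_Icc.exists_bound_of_continuousOn hc
      refine ⟨|C|, abs_nonneg _, fun x y h1 h2 => ?_⟩
      refine (gamma_lower x y (by linarith)).trans ?_
      rw [pow_zero, mul_one, div_eq_inv_mul]
      gcongr
      exact (le_abs_self _).trans ((hC x ⟨h1, h2⟩).trans (le_abs_self _))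
    | succ K ih =>
      intro A B h
      obtain ⟨C, hC0, hC⟩ := ih (A+1) (B+1) (by push_cast at h; linarith)
      refine ⟨(1 + |A| + |B|) * C, by positivity, fun x y h1 h2 => ?_⟩
      rw [Complex.one_div_Gamma_eq_self_mul_one_div_Gamma_add_one, norm_mul]
      have h3 := hC (x+1) y (by linarith) (by linarith)
      have e : (((x+1:ℝ) : ℂ) + y * Complex.I) = (x + y * Complex.I) + 1 := by push_cast; ring
      rw [e] at h3
      have h4 : ‖(x + y * Complex.I : ℂ)‖ ≤ (1 + |A| + |B|) * (1 + |y|) := by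
        have : ‖(x + y * Complex.I : ℂ)‖ ≤ |x| + |y| := by
          refine (norm_add_le _ _).trans ?_
          simp
        have hx : |x| ≤ |A| + |B| := by
          rw [abs_le]; constructor
          · linarith [neg_abs_le A, abs_nonneg B]
          · linarith [le_abs_self B, abs_nonneg A]
        nlinarith [abs_nonneg A, abs_nonneg B, abs_nonneg y, mul_nonneg (abs_nonneg A) (abs_nonneg y), mul_nonneg (abs_nonneg B) (abs_nonneg y)]
      calc _ ≤ ((1 + |A| + |B|) * (1 + |y|)) * (C * (1 + |y|) ^ K * Real.sqrt (Real.cosh (Real.pi * y))) := by gcongr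
        _ = _ := by rw [pow_succ]; ring
  obtain ⟨K, hK⟩ := exists_nat_ge (1/2 - A)
  obtain ⟨C, h0, h⟩ := key K A B (by linarith)
  exact ⟨C, h0, K, h⟩

lemma summable_fw (a b d α R : ℝ) (ha : 0 < a) (hb : 0 < b) (hd : 0 < d) (hα : 0 < α) (hα2 : α < 2)
    (hR : 0 ≤ R) : Summable (fun j : ℕ => Real.Gamma (a + j * α) / (Real.Gamma (b + j) * Real.Gamma (d + j)) * R ^ j) := by
  refine summable_of_ratio_norm_eventually_le (r := 1/2) (by norm_num) ?_
  have hlim : Filter.Tendsto (fun j : ℕ => 4 * (a + α + 1)^α * R * ((j:ℝ) + 1) ^ (-(2 - α))) Filter.atTop (nhds (4 * (a + α + 1)^α * R * 0)) := by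
    refine Filter.Tendsto.const_mul _ ?_
    exact (tendsto_rpow_neg_atTop (by linarith)).comp
      (Filter.tendsto_atTop_add_const_right _ 1 tendsto_natCast_atTop_atTop)
  rw [mul_zero] at hlim
  filter_upwards [hlim.eventually (gt_mem_nhds (by norm_num : (0:ℝ) < 1/2)), Filter.eventually_ge_atTop 1] with j hj hj1
  have hj1' : (1:ℝ) ≤ j := by exact_mod_cast hj1
  have hj0 : (0:ℝ) ≤ j := by positivity
  have hx : 0 < a + j * α := by positivity
  have g0 := Real.Gamma_pos_of_pos hx
  have gb := Real.Gamma_pos_of_pos (show 0 < b + j by positivity)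
  have gd := Real.Gamma_pos_of_pos (show 0 < d + j by positivity)
  have h1 : Real.Gamma (a + ((j+1 : ℕ):ℝ) * α) ≤ Real.Gamma (a + j * α) * (a + j*α + 1) ^ α := by
    set x := a + j * α
    have := Real.Gamma_mul_add_mul_le_rpow_Gamma_mul_rpow_Gamma (s := x) (t := x + 2) (a := 1 - α/2) (b := α/2) hx (by linarith) (by linarith) (by linarith) (by ring)
    have e : (1 - α/2) * x + α/2 * (x+2) = a + ((j+1 : ℕ):ℝ) * α := by push_cast; ring
    rw [e] at this
    refine this.trans ?_
    have e2 : Real.Gamma (x+2) = (x+1) * x * Real.Gamma x := by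
      rw [show x + 2 = (x+1)+1 by ring, Real.Gamma_add_one (by linarith), Real.Gamma_add_one (by linarith)]; ring
    rw [e2, Real.mul_rpow (by positivity) g0.le]
    have e3 : Real.Gamma x ^ (1 - α/2) * Real.Gamma x ^ (α/2) = Real.Gamma x := by
      rw [← Real.rpow_add g0]; simp
    have e4 : ((x+1) * x) ^ (α/2) ≤ (x+1)^α := by
      calc ((x+1) * x) ^ (α/2) ≤ ((x+1)^(2:ℝ)) ^ (α/2) := by
            apply Real.rpow_le_rpow (by positivity) _ (by linarith)
            rw [Real.rpow_two]; nlinarith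
        _ = _ := by rw [← Real.rpow_mul (by positivity)]; congr 1; ring
    calc _ = (Real.Gamma x ^ (1 - α/2) * Real.Gamma x ^ (α/2)) * ((x+1) * x) ^ (α/2) := by ring
      _ ≤ _ := by rw [e3]; gcongr
  have eb : Real.Gamma (b + ((j+1:ℕ):ℝ)) = (b + j) * Real.Gamma (b + j) := by
    rw [← Real.Gamma_add_one (by positivity)]; push_cast; ring_nf
  have ed : Real.Gamma (d + ((j+1:ℕ):ℝ)) = (d + j) * Real.Gamma (d + j) := by
    rw [← Real.Gamma_add_one (by positivity)]; push_cast; ring_nf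
  have g1 := Real.Gamma_pos_of_pos (show 0 < a + ((j+1 : ℕ):ℝ) * α by positivity)
  rw [eb, ed, Real.norm_of_nonneg (by positivity), Real.norm_of_nonneg (by positivity)]
  have hq : (a + j*α + 1) ^ α * R / ((b+j) * (d+j)) ≤ 1/2 := by
    refine le_trans ?_ hj.le
    have q1 : (a + j*α + 1) ^ α ≤ (a + α + 1)^α * ((j:ℝ)+1)^α := by
      rw [← Real.mul_rpow (by positivity) (by positivity)]
      apply Real.rpow_le_rpow (by positivity) _ hα.le
      nlinarith
    have q2 : ((j:ℝ)+1)^(-(2-α)) = ((j:ℝ)+1)^α / ((j:ℝ)+1)^2 := by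
      rw [neg_sub, Real.rpow_sub (by positivity), Real.rpow_two]
    have q3 : ((j:ℝ)+1)^2/4 ≤ (b+j)*(d+j) := by nlinarith [mul_pos hb hd]
    rw [q2]
    calc _ ≤ ((a + α + 1)^α * ((j:ℝ)+1)^α) * R / (((j:ℝ)+1)^2/4) := by gcongr
      _ = _ := by field_simp
  calc _ ≤ (Real.Gamma (a + j * α) * (a + j*α + 1) ^ α) / ((b + j) * Real.Gamma (b + j) * ((d + j) * Real.Gamma (d + j))) * R^(j+1) := by gcongr
    _ = ((a + j*α + 1) ^ α * R / ((b+j) * (d+j))) * (Real.Gamma (a + j * α) / (Real.Gamma (b + j) * Real.Gamma (d + j)) * R ^ j) := by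
      rw [pow_succ]; field_simp
    _ ≤ _ := by gcongr

lemma integral_inv_line (a T : ℝ) (ha : a ≠ 0) :
    ∫ y in (-T)..T, (1 : ℂ) / ((a:ℂ) + y * Complex.I) = ((2 * Real.arctan (T / a) : ℝ) : ℂ) := by
  have hpos : ∀ y : ℝ, 0 < a^2 + y^2 := fun y => by positivity
  have hd : ∀ y : ℝ, HasDerivAt (fun y : ℝ => ((Real.arctan (y / a) : ℝ) : ℂ) - ((Real.log (a^2+y^2) / 2 : ℝ) : ℂ) * Complex.I)
      ((1:ℂ) / ((a:ℂ) + y * Complex.I)) y := by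
    intro y
    have h1 := ((hasDerivAt_id y).div_const a).arctan.ofReal_comp
    have h2 := (((((hasDerivAt_id y).pow 2).const_add (a^2)).log (hpos y).ne').div_const 2).ofReal_comp.mul_const Complex.I
    refine (h1.sub h2).congr_deriv ?_
    have hne : (a + y * Complex.I : ℂ) ≠ 0 := by
      intro h; have := congrArg Complex.re h; simp at this; exact ha this
    have hne2 : ((a:ℂ)^2 + (y:ℂ)^2) ≠ 0 := by exact_mod_cast (hpos y).ne'
    have ha' : (a:ℂ) ≠ 0 := by exact_mod_cast ha
    rw [eq_div_iff hne]
    have h5 : (1 / (1 + (y/a)^2) * (1/a)) = a / (a^2+y^2) := by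
      have := (hpos y).ne'
      field_simp
    simp only [Pi.pow_apply, id]
    rw [h5]
    push_cast
    field_simp
    ring_nf
    simp only [Complex.I_sq]
    ring
  have hne : ∀ y : ℝ, (a + y * Complex.I : ℂ) ≠ 0 := by
    intro y h; have := congrArg Complex.re h; simp at this; exact ha this
  rw [intervalIntegral.integral_eq_sub_of_hasDerivAt (fun y _ => hd y)
    (Continuous.intervalIntegrable (by fun_prop (disch := exact hne _)) _ _)]
  rw [neg_div, Real.arctan_neg]
  push_cast
  rw [neg_sq]; ring

lemma strip_shift (f h : ℂ → ℂ) (c : ℂ) (p a b C : ℝ) (ha : 0 < a) (hb : 0 < b)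
    (hh : DifferentiableOn ℂ h {z | p - b ≤ z.re ∧ z.re ≤ p + a})
    (hf : ∀ z : ℂ, p - b ≤ z.re → z.re ≤ p + a → z ≠ p → f z = c / (z - p) + h z)
    (hbd : ∀ x y : ℝ, p - b ≤ x → x ≤ p + a → 1 ≤ |y| → ‖f (x + y * Complex.I)‖ ≤ C / y ^ 2)
    (hi1 : Integrable (fun y : ℝ => f ((p + a : ℝ) + y * Complex.I)))
    (hi2 : Integrable (fun y : ℝ => f ((p - b : ℝ) + y * Complex.I))) :
    (∫ y : ℝ, f ((p + a : ℝ) + y * Complex.I)) - (∫ y : ℝ, f ((p - b : ℝ) + y * Complex.I))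
      = 2 * Real.pi * c := by
  have t1 := intervalIntegral_tendsto_integral hi1 Filter.tendsto_neg_atTop_atBot Filter.tendsto_id
  have t2 := intervalIntegral_tendsto_integral hi2 Filter.tendsto_neg_atTop_atBot Filter.tendsto_id
  have t3 : Filter.Tendsto (fun T : ℝ => (((2 * Real.arctan (T / a) - 2 * Real.arctan (T / (-b)) : ℝ)) : ℂ) * c)
      Filter.atTop (nhds (2 * Real.pi * c)) := by
    have h1 : Filter.Tendsto (fun T : ℝ => Real.arctan (T / a)) Filter.atTop (nhds (Real.pi/2)) :=
      (tendsto_nhds_of_tendsto_nhdsWithin Real.tendsto_arctan_atTop).comp (Filter.tendsto_id.atTop_div_const ha)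
    have h2 : Filter.Tendsto (fun T : ℝ => Real.arctan (T / (-b))) Filter.atTop (nhds (-(Real.pi/2))) :=
      (tendsto_nhds_of_tendsto_nhdsWithin Real.tendsto_arctan_atBot).comp
        (Filter.tendsto_id.atTop_div_const_of_neg (by linarith))
    have h3 := (Complex.continuous_ofReal.tendsto _).comp ((h1.const_mul 2).sub (h2.const_mul 2))
    have h4 := h3.mul_const c
    have e : (((2 * (Real.pi / 2) - 2 * -(Real.pi / 2) : ℝ)) : ℂ) * c = 2 * Real.pi * c := by
      push_cast; ring
    rw [e] at h4
    exact h4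
  have t4 := (t1.sub t2).sub t3
  have t5 : Filter.Tendsto (fun T : ℝ => (a + b) * (C / T^2 + ‖c‖ / T) + (a + b) * (C / T^2 + ‖c‖ / T)) Filter.atTop (nhds 0) := by
    have h1 : Filter.Tendsto (fun T : ℝ => C / T^2) Filter.atTop (nhds 0) :=
      Filter.Tendsto.const_div_atTop (Filter.tendsto_pow_atTop (by norm_num)) C
    have h2 : Filter.Tendsto (fun T : ℝ => ‖c‖ / T) Filter.atTop (nhds 0) :=
      Filter.Tendsto.const_div_atTop Filter.tendsto_id _
    have := ((h1.add h2).const_mul (a+b)).add ((h1.add h2).const_mul (a+b))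
    simpa using this
  have hz : Filter.Tendsto (fun T : ℝ => ((∫ y in (-T)..(id T), f ((p + a : ℝ) + y * Complex.I)) - (∫ y in (-T)..(id T), f ((p - b : ℝ) + y * Complex.I)))
      - (((2 * Real.arctan (T / a) - 2 * Real.arctan (T / (-b)) : ℝ)) : ℂ) * c) Filter.atTop (nhds 0) := by
    refine squeeze_zero_norm' ?_ t5
    filter_upwards [Filter.eventually_ge_atTop (1:ℝ)] with T hT
    have hT0 : 0 < T := by linarith
    have hint : ∀ q : ℝ, p - b ≤ q → q ≤ p + a → IntervalIntegrable (fun y : ℝ => h ((q:ℝ) + y * Complex.I)) volume (-T) T := by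
      intro q h1 h2
      apply Continuous.intervalIntegrable
      refine hh.continuousOn.comp_continuous (by fun_prop) ?_
      intro y; constructor <;> simp <;> linarith
    have hkint : ∀ q : ℝ, q ≠ 0 → IntervalIntegrable (fun y : ℝ => (1:ℂ) / ((q:ℝ) + y * Complex.I)) volume (-T) T := by
      intro q hq
      have hne : ∀ y : ℝ, (q + y * Complex.I : ℂ) ≠ 0 := by
        intro y h; have := congrArg Complex.re h; simp at this; exact hq this
      exact Continuous.intervalIntegrable (by fun_prop (disch := exact hne _)) _ _
    have line : ∀ d : ℝ, d ≠ 0 → -b ≤ d → d ≤ a → (∫ y in (-T)..(id T), f ((p + d : ℝ) + y * Complex.I))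
        = c * ((2 * Real.arctan (T / d) : ℝ) : ℂ) + ∫ y in (-T)..T, h ((p + d : ℝ) + y * Complex.I) := by
      intro d hd h1 h2
      rw [← integral_inv_line d T hd, ← intervalIntegral.integral_const_mul,
        ← intervalIntegral.integral_add ((hkint d hd).const_mul c) (hint _ (by linarith) (by linarith))]
      refine intervalIntegral.integral_congr fun y _ => ?_
      have hre : (((p + d : ℝ) : ℂ) + y * Complex.I).re = p + d := by simp
      rw [hf _ (by rw [hre]; linarith) (by rw [hre]; linarith)]
      · congr 1
        rw [mul_one_div]
        congr 1; push_cast; ring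
      · intro h; have := congrArg Complex.re h; rw [hre] at this; simp at this; exact hd this
    have rect := Complex.integral_boundary_rect_eq_zero_of_differentiableOn h
      (((p - b : ℝ) : ℂ) + ((-T:ℝ):ℂ) * Complex.I) (((p + a : ℝ) : ℂ) + ((T:ℝ):ℂ) * Complex.I) (by
        refine hh.mono ?_
        intro z hz
        have := hz.1
        simp only [Set.mem_preimage, Complex.add_re, Complex.ofReal_re, Complex.mul_re, Complex.I_re, Complex.ofReal_im, Complex.I_im] at this
        rw [Set.uIcc_of_le (by linarith)] at this
        constructor <;> [(have := this.1); (have := this.2)] <;> linarith)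
    have r1 : ∀ q t : ℝ, ((q:ℂ) + (t:ℂ) * Complex.I).re = q := by simp
    have r2 : ∀ q t : ℝ, ((q:ℂ) + (t:ℂ) * Complex.I).im = t := by simp
    rw [r1, r1, r2, r2] at rect
    have L1 := line a ha.ne' (by linarith) le_rfl
    have L2 := line (-b) (by linarith) le_rfl (by linarith)
    rw [← sub_eq_add_neg] at L2
    rw [L1, L2]
    have hor : ∀ t : ℝ, |t| = T → ‖∫ x in (p-b)..(p+a), h (x + t * Complex.I)‖ ≤ (a+b) * (C / T^2 + ‖c‖ / T) := by
      intro t ht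
      have := intervalIntegral.norm_integral_le_of_norm_le_const (a := p - b) (b := p + a) (C := C / T^2 + ‖c‖ / T)
        (f := fun x : ℝ => h (x + t * Complex.I)) (by
          intro x hx
          rw [Set.uIoc_of_le (by linarith)] at hx
          have htne : (x + t * Complex.I : ℂ) ≠ p := by
            intro h; have := congrArg Complex.im h; simp at this
            rw [this] at ht; simp at ht; linarith
          have e := hf (x + t * Complex.I) (by rw [r1]; exact hx.1.le) (by rw [r1]; exact hx.2) htne
          have e' : h (x + t * Complex.I) = f (x + t * Complex.I) - c / (x + t * Complex.I - p) := by
            rw [e]; ring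
          rw [e']
          refine (norm_sub_le _ _).trans ?_
          have b1 := hbd x t hx.1.le hx.2 (by rw [ht]; exact hT)
          rw [← sq_abs, ht] at b1
          refine add_le_add b1 ?_
          rw [norm_div]
          have : T ≤ ‖(x + t * Complex.I - p : ℂ)‖ := by
            have := Complex.abs_im_le_norm (x + t * Complex.I - p : ℂ)
            simp at this; rw [ht] at this; exact this
          gcongr)
      refine this.trans_eq ?_
      rw [abs_of_nonneg (by linarith)]; ring
    have hb1 := hor (-T) (by rw [abs_neg, abs_of_pos hT0])
    have hb2 := hor T (abs_of_pos hT0)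
    set H1 := ∫ x in (p-b)..(p+a), h (x + ((-T:ℝ):ℂ) * Complex.I)
    set H2 := ∫ x in (p-b)..(p+a), h (x + ((T:ℝ):ℂ) * Complex.I)
    set V1 := ∫ y in (-T)..T, h ((p + a : ℝ) + y * Complex.I)
    set V2 := ∫ y in (-T)..T, h ((p - b : ℝ) + y * Complex.I)
    simp only [smul_eq_mul] at rect
    have hv : V1 - V2 = Complex.I * (H1 - H2) := by
      linear_combination (-Complex.I) * rect + (V1 - V2) * Complex.I_sq
    calc _ = ‖V1 - V2‖ := by congr 1; push_cast; ring
      _ = ‖H1 - H2‖ := by rw [hv, norm_mul, Complex.norm_I, one_mul]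
      _ ≤ ‖H1‖ + ‖H2‖ := norm_sub_le _ _
      _ ≤ _ := add_le_add hb1 hb2
  have := tendsto_nhds_unique t4 hz
  exact sub_eq_zero.mp this

lemma norm_sin_sq (a b : ℝ) : ‖Complex.sin (a + b * Complex.I)‖ ^ 2 = Real.sin a ^ 2 + Real.sinh b ^ 2 := by
  rw [Complex.sin_add_mul_I, ← Complex.ofReal_sin, ← Complex.ofReal_cosh, ← Complex.ofReal_cos,
    ← Complex.ofReal_sinh, ← Complex.ofReal_mul, ← Complex.ofReal_mul, Complex.norm_add_mul_I,
    Real.sq_sqrt (by positivity)]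
  have h1 := Real.sin_sq_add_cos_sq a
  have h2 := Real.cosh_sq b
  rw [mul_pow, mul_pow, h2]
  linear_combination (Real.sinh b)^2 * h1

/-- the integrand -/
noncomputable def ffun (n : ℕ) (s ν r : ℝ) (z : ℂ) : ℂ :=
  (r:ℂ) ^ (-z) * (2 ^ z * Complex.Gamma ((ν:ℂ) + ((n:ℂ) - z)/(2*(s:ℂ))) *
        Complex.Gamma (z/2) / Complex.Gamma (((n:ℂ) - z)/2))

lemma gamma_refl (z : ℂ) (h : Complex.sin (Real.pi * z) ≠ 0) :
    ‖Complex.Gamma z‖ = Real.pi / ‖Complex.sin (Real.pi * z)‖ * ‖(Complex.Gamma (1 - z))⁻¹‖ := by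
  have h1 := Complex.Gamma_mul_Gamma_one_sub z
  have h2 : Complex.Gamma (1 - z) ≠ 0 := by
    intro h0
    rw [h0, mul_zero] at h1
    have : (Real.pi : ℂ) / Complex.sin (Real.pi * z) ≠ 0 :=
      div_ne_zero (by exact_mod_cast Real.pi_ne_zero) h
    exact this h1.symm
  have h3 : Complex.Gamma z = Real.pi / Complex.sin (Real.pi * z) * (Complex.Gamma (1 - z))⁻¹ := by
    rw [← h1]; field_simp
  rw [h3, norm_mul, norm_div, Complex.norm_real, Real.norm_of_nonneg Real.pi_pos.le]

lemma ffun_norm (n : ℕ) (s ν r : ℝ) (hr : 0 < r) (x y : ℝ)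
    (h : Complex.sin ((Real.pi * (x/2) : ℝ) + (Real.pi * (y/2) : ℝ) * Complex.I) ≠ 0) :
    ‖ffun n s ν r (x + y * Complex.I)‖ = r ^ (-x) * 2 ^ x *
      ‖Complex.Gamma ((ν + (n - x)/(2*s) : ℝ) + (-y/(2*s) : ℝ) * Complex.I)‖ *
      (Real.pi / ‖Complex.sin ((Real.pi * (x/2) : ℝ) + (Real.pi * (y/2) : ℝ) * Complex.I)‖) *
      ‖(Complex.Gamma ((1 - x/2 : ℝ) + (-y/2 : ℝ) * Complex.I))⁻¹‖ *
      ‖(Complex.Gamma (((n - x)/2 : ℝ) + (-y/2 : ℝ) * Complex.I))⁻¹‖ := by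
  have e0 : ((Real.pi * (x/2) : ℝ) + (Real.pi * (y/2) : ℝ) * Complex.I : ℂ) = Real.pi * ((x + y * Complex.I)/2) := by
    push_cast; ring
  rw [e0] at h ⊢
  have e1 : ((ν + (n - x)/(2*s) : ℝ) + (-y/(2*s) : ℝ) * Complex.I : ℂ) = (ν:ℂ) + ((n:ℂ) - (x + y * Complex.I))/(2*(s:ℂ)) := by
    push_cast; ring
  have e2 : ((1 - x/2 : ℝ) + (-y/2 : ℝ) * Complex.I : ℂ) = 1 - (x + y * Complex.I)/2 := by
    push_cast; ring
  have e3 : (((n - x)/2 : ℝ) + (-y/2 : ℝ) * Complex.I : ℂ) = ((n:ℂ) - (x + y * Complex.I))/2 := by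
    push_cast; ring
  rw [e1, e2, e3, ffun, norm_mul, norm_div, norm_mul, norm_mul, gamma_refl _ h,
    Complex.norm_cpow_eq_rpow_re_of_pos hr, norm_inv (Complex.Gamma (((n:ℂ) - (x + y * Complex.I))/2))]
  have e4 : ‖(2:ℂ) ^ (x + y * Complex.I)‖ = 2 ^ x := by
    have := Complex.norm_cpow_eq_rpow_re_of_pos (x := 2) (by norm_num) (x + y * Complex.I)
    simpa using this
  have e5 : (-(x + y * Complex.I : ℂ)).re = -x := by simp
  rw [e4, e5]
  ring

lemma ffun_bound (n : ℕ) (s ν r : ℝ) (hs : 0 < s) (hr : 0 < r) (A B : ℝ) (hB : B < 2*s*ν + n) :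
    ∃ C : ℝ, 0 ≤ C ∧ ∀ x y : ℝ, A ≤ x → x ≤ B → 1 ≤ |y| →
      ‖ffun n s ν r (x + y * Complex.I)‖ ≤ C / y^2 := by
  obtain ⟨C1, hC1, K1, h1⟩ := inv_gamma_strip (1 - B/2) (1 - A/2)
  obtain ⟨C2, hC2, K2, h2⟩ := inv_gamma_strip ((n - B)/2) ((n - A)/2)
  set K := K1 + K2 + 2 with hK
  have hpos : ∀ x ≤ B, 0 < ν + (n - x)/(2*s) := by
    intro x hx
    have : 0 < (2 * s * ν + n - x) / (2*s) := by apply div_pos <;> linarith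
    have e : (2 * s * ν + n - x) / (2*s) = ν + (n - x)/(2*s) := by field_simp; ring
    linarith
  have c1 : ContinuousOn (fun x : ℝ => r ^ (-x) * 2 ^ x) (Set.Icc A B) := by
    apply Continuous.continuousOn
    have := Real.continuous_const_rpow hr.ne'
    have := Real.continuous_const_rpow (two_ne_zero)
    fun_prop
  have c2 : ContinuousOn (fun x : ℝ => Real.Gamma (ν + (n - x)/(2*s) + K)) (Set.Icc A B) := by
    intro x hx
    have h0 := hpos x hx.2
    refine ContinuousAt.continuousWithinAt ?_
    have : ContinuousAt Real.Gamma (ν + (n - x)/(2*s) + K) := by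
      refine (Real.differentiableAt_Gamma fun m => ?_).continuousAt
      have : (0:ℝ) ≤ m := by positivity
      have : (0:ℝ) ≤ K := by positivity
      linarith
    exact ContinuousAt.comp (f := fun x : ℝ => ν + (n - x)/(2*s) + K) this (by fun_prop)
  obtain ⟨M1, hM1⟩ := isCompact_Icc.exists_bound_of_continuousOn c1
  obtain ⟨M2, hM2⟩ := isCompact_Icc.exists_bound_of_continuousOn c2
  refine ⟨|M1| * (|M2| * (2*s)^K) * (2 * Real.pi) * (C1 * 2^K1) * (C2 * 2^K2), by positivity, ?_⟩
  intro x y hx1 hx2 hy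
  have hy0 : 0 < |y| := by linarith
  have hsin := norm_sin_sq (Real.pi * (x/2)) (Real.pi * (y/2))
  set S := ‖Complex.sin ((Real.pi * (x/2) : ℝ) + (Real.pi * (y/2) : ℝ) * Complex.I)‖ with hS
  have hsh : 1 ≤ Real.sinh (Real.pi * (y/2)) ^ 2 := by
    rw [← sq_abs, Real.abs_sinh]
    have : 1 ≤ Real.sinh |Real.pi * (y/2)| := by
      have h1 : |Real.pi * (y/2)| ≤ Real.sinh |Real.pi * (y/2)| := Real.self_le_sinh_iff.mpr (abs_nonneg _)
      refine le_trans ?_ h1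
      rw [abs_mul, abs_div, abs_of_pos Real.pi_pos, abs_two]
      nlinarith [Real.pi_gt_three]
    nlinarith
  have hch := Real.cosh_sq (Real.pi * (y/2))
  have hcp := Real.cosh_pos (Real.pi * (y/2))
  set H := Real.cosh (Real.pi * (y/2)) with hH
  have hS0 : 0 ≤ S := norm_nonneg _
  have hHS : H ≤ 2 * S := by
    refine (sq_le_sq₀ hcp.le (by positivity)).mp ?_
    nlinarith [sq_nonneg (Real.sin (Real.pi * (x/2)))]
  have hSp : 0 < S := by linarith
  have hcosh : Real.cosh (Real.pi * (-y/2)) = H := by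
    rw [hH, ← Real.cosh_neg]; congr 1; ring
  have g1 := h1 (1 - x/2) (-y/2) (by linarith) (by linarith)
  have g2 := h2 ((n-x)/2) (-y/2) (by linarith) (by linarith)
  rw [hcosh] at g1 g2
  have hy2 : 1 + |-y/2| ≤ 2 * |y| := by
    rw [abs_div, abs_neg, abs_two]; linarith
  have g3 := gamma_upper K (ν + (n - x)/(2*s)) (-y/(2*s)) (hpos x hx2)
  have g4 := hM1 x ⟨hx1, hx2⟩
  have g5 := hM2 x ⟨hx1, hx2⟩
  rw [ffun_norm n s ν r hr x y (norm_pos_iff.mp hSp), ← hS]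
  have hyK : |-y/(2*s)| ^ K = |y|^K / (2*s)^K := by
    rw [abs_div, abs_neg, abs_of_pos (by positivity : 0 < 2*s), div_pow]
  rw [hyK] at g3
  have g3' : ‖Complex.Gamma ((ν + (n - x)/(2*s) : ℝ) + (-y/(2*s) : ℝ) * Complex.I)‖ ≤ |M2| * (2*s)^K / |y|^K := by
    rw [le_div_iff₀ (by positivity)]
    have : ‖Complex.Gamma ((ν + (n - x)/(2*s) : ℝ) + (-y/(2*s) : ℝ) * Complex.I)‖ * (|y|^K / (2*s)^K) ≤ |M2| :=
      g3.trans ((le_abs_self _).trans (g5.trans (le_abs_self _)))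
    rw [← mul_div_assoc, div_le_iff₀ (by positivity)] at this
    exact this
  have g4' : r ^ (-x) * 2 ^ x ≤ |M1| := (le_abs_self _).trans (g4.trans (le_abs_self _))
  have hq0 : 0 < Real.sqrt H := Real.sqrt_pos.mpr hcp
  have hqq : Real.sqrt H * Real.sqrt H = H := Real.mul_self_sqrt hcp.le
  calc _ ≤ |M1| * (|M2| * (2*s)^K / |y|^K) * (Real.pi / S) * (C1 * (2 * |y|)^K1 * Real.sqrt H) * (C2 * (2*|y|)^K2 * Real.sqrt H) := by
        gcongr
        · exact g1.trans (by gcongr)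
        · exact g2.trans (by gcongr)
    _ = |M1| * (|M2| * (2*s)^K) * (Real.pi / S * (Real.sqrt H * Real.sqrt H)) * (C1 * 2^K1) * (C2 * 2^K2) * (|y|^K1 * |y|^K2/|y|^K) := by
        rw [mul_pow, mul_pow]; ring
    _ ≤ |M1| * (|M2| * (2*s)^K) * (2 * Real.pi) * (C1 * 2^K1) * (C2 * 2^K2) * (|y|^K1 * |y|^K2/|y|^K) := by
        rw [hqq]
        have : Real.pi / S * H ≤ 2 * Real.pi := by
          rw [div_mul_eq_mul_div, div_le_iff₀ hSp]
          nlinarith [Real.pi_pos]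
        gcongr
    _ = _ := by
        rw [hK, pow_add, pow_add, ← sq_abs y]
        field_simp
        ring

lemma ffun_differentiableAt (n : ℕ) (s ν r : ℝ) (hs : 0 < s) (hr : 0 < r) (z : ℂ)
    (hz : z.re < 2*s*ν + n) (hz2 : ∀ m : ℕ, z ≠ -2 * m) : DifferentiableAt ℂ (ffun n s ν r) z := by
  have hr' : (r:ℂ) ≠ 0 := by exact_mod_cast hr.ne'
  have d1 : DifferentiableAt ℂ (fun z : ℂ => (r:ℂ) ^ (-z)) z :=
    DifferentiableAt.const_cpow (by fun_prop) (Or.inl hr')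
  have d2 : DifferentiableAt ℂ (fun z : ℂ => (2:ℂ) ^ z) z :=
    DifferentiableAt.const_cpow (by fun_prop) (Or.inl two_ne_zero)
  have d3 : DifferentiableAt ℂ (fun z : ℂ => Complex.Gamma ((ν:ℂ) + ((n:ℂ) - z)/(2*(s:ℂ)))) z := by
    refine DifferentiableAt.comp (f := fun z : ℂ => (ν:ℂ) + ((n:ℂ) - z)/(2*(s:ℂ))) z (Complex.differentiableAt_Gamma _ fun m h => ?_) (by fun_prop)
    have := congrArg Complex.re h
    have e : ((ν:ℂ) + ((n:ℂ) - z)/(2*(s:ℂ))).re = ν + (n - z.re)/(2*s) := by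
      rw [show (2*(s:ℂ)) = ((2*s:ℝ):ℂ) by push_cast; ring, Complex.add_re, Complex.div_ofReal_re]; simp
    rw [e] at this
    have h0 : 0 < (2 * s * ν + n - z.re) / (2*s) := by apply div_pos <;> linarith
    have e : (2 * s * ν + n - z.re) / (2*s) = ν + (n - z.re)/(2*s) := by field_simp; ring
    simp at this
    have : (0:ℝ) ≤ m := by positivity
    linarith
  have d4 : DifferentiableAt ℂ (fun z : ℂ => (Complex.Gamma (((n:ℂ) - z)/2))⁻¹) z := 
    DifferentiableAt.comp (f := fun z : ℂ => ((n:ℂ) - z)/2) z (Complex.differentiable_one_div_Gamma _) (by fun_prop)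
  have d5 : DifferentiableAt ℂ (fun z : ℂ => Complex.Gamma (z/2)) z := by
    refine DifferentiableAt.comp (f := fun z : ℂ => z/2) z (Complex.differentiableAt_Gamma _ fun m h => ?_) (by fun_prop)
    apply hz2 m
    linear_combination 2 * h
  have : ffun n s ν r = fun z : ℂ => (r:ℂ) ^ (-z) * (2 ^ z * Complex.Gamma ((ν:ℂ) + ((n:ℂ) - z)/(2*(s:ℂ))) *
        Complex.Gamma (z/2) * (Complex.Gamma (((n:ℂ) - z)/2))⁻¹) := by
    funext z; rw [ffun, div_eq_mul_inv]
  rw [this]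
  exact d1.mul (((d2.mul d3).mul d5).mul d4)

lemma ffun_integrable (n : ℕ) (s ν r : ℝ) (hs : 0 < s) (hr : 0 < r) (x : ℝ)
    (hz : x < 2*s*ν + n) (hz2 : ∀ m : ℕ, x ≠ -2 * m) :
    Integrable (fun y : ℝ => ffun n s ν r (x + y * Complex.I)) := by
  have hc : Continuous (fun y : ℝ => ffun n s ν r (x + y * Complex.I)) := by
    rw [continuous_iff_continuousAt]
    intro y
    have hcy : ContinuousAt (fun y : ℝ => (x + y * Complex.I : ℂ)) y :=
      Continuous.continuousAt (by fun_prop)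
    suffices hcf : ContinuousAt (ffun n s ν r) (x + y * Complex.I) by
      exact ContinuousAt.comp (f := fun y : ℝ => (x + y * Complex.I : ℂ)) hcf hcy
    refine (ffun_differentiableAt n s ν r hs hr _ (by simpa using hz) fun m h => ?_).continuousAt
    apply hz2 m
    have := congrArg Complex.re h
    simpa using this
  obtain ⟨C, hC0, hC⟩ := ffun_bound n s ν r hs hr x x hz
  obtain ⟨M, hM⟩ := (isCompact_Icc (a := (-1:ℝ)) (b := 1)).exists_bound_of_continuousOn hc.continuousOn
  refine Integrable.mono' (integrable_inv_one_add_sq.const_mul (2 * C + 2 * |M|)) hc.aestronglyMeasurable ?_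
  refine Filter.Eventually.of_forall fun y => ?_
  have hp : 0 < 1 + y^2 := by positivity
  rw [← div_eq_mul_inv, le_div_iff₀ hp]
  rcases le_total 1 |y| with h | h
  · have h1 := hC x y le_rfl le_rfl h
    have hy2 : 1 ≤ y^2 := by rw [← sq_abs]; nlinarith
    have h2 : ‖ffun n s ν r (x + y * Complex.I)‖ * y^2 ≤ C := by
      rwa [le_div_iff₀ (by linarith)] at h1
    nlinarith [norm_nonneg (ffun n s ν r (x + y * Complex.I)), abs_nonneg M]
  · have h1 := (hM y (abs_le.mp h)).trans (le_abs_self M)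
    have hy2 : y^2 ≤ 1 := by rw [← sq_abs]; nlinarith [abs_nonneg y]
    nlinarith [norm_nonneg (ffun n s ν r (x + y * Complex.I)), abs_nonneg M]

lemma gamma_prod (w : ℂ) (j : ℕ) (h : ∀ k < j, w + k ≠ 0) :
    (∏ k ∈ Finset.range j, (w + k)) * Complex.Gamma w = Complex.Gamma (w + j) := by
  induction j with
  | zero => simp
  | succ j ih =>
    rw [Finset.prod_range_succ, mul_right_comm, ih fun k hk => h k (by omega)]
    have := Complex.Gamma_add_one (w + j) (h j (by omega))
    push_cast
    rw [← add_assoc, this]; ring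

lemma prod_neg (j : ℕ) : ∏ k ∈ Finset.range j, (-(j:ℂ) + k) = (-1)^j * (j.factorial : ℂ) := by
  induction j with
  | zero => simp
  | succ j ih =>
    rw [Finset.prod_range_succ']
    have : ∀ k ∈ Finset.range j, (-((j+1:ℕ):ℂ) + ((k+1 : ℕ):ℂ)) = -(j:ℂ) + k := by
      intro k _; push_cast; ring
    rw [Finset.prod_congr rfl this, ih, Nat.factorial_succ]
    push_cast; ring

/-- `(z + 2 j)` times the integrand -/
noncomputable def gfun (n : ℕ) (s ν r : ℝ) (j : ℕ) (z : ℂ) : ℂ :=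
  (r:ℂ) ^ (-z) * 2 ^ z * Complex.Gamma ((ν:ℂ) + ((n:ℂ) - z)/(2*(s:ℂ))) *
    (Complex.Gamma (((n:ℂ) - z)/2))⁻¹ * (2 * Complex.Gamma (z/2 + j + 1)) *
    (∏ k ∈ Finset.range j, (z/2 + k))⁻¹

lemma gfun_eq (n : ℕ) (s ν r : ℝ) (j : ℕ) (z : ℂ) (h : ∀ k < j, z/2 + k ≠ 0) (hj : z ≠ -2 * j) :
    gfun n s ν r j z = (z + 2 * j) * ffun n s ν r z := by
  have hj' : z/2 + j ≠ 0 := fun h0 => hj (by linear_combination 2 * h0)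
  have hp : ∏ k ∈ Finset.range j, (z/2 + k) ≠ 0 :=
    Finset.prod_ne_zero_iff.mpr fun k hk => h k (Finset.mem_range.mp hk)
  rw [gfun, ffun, Complex.Gamma_add_one _ hj', ← gamma_prod _ j h]
  set P := ∏ k ∈ Finset.range j, (z/2 + (k:ℂ))
  have hPP : P * P⁻¹ = 1 := mul_inv_cancel₀ hp
  set G1 := Complex.Gamma ((ν:ℂ) + ((n:ℂ) - z)/(2*(s:ℂ)))
  set G2 := Complex.Gamma (((n:ℂ) - z)/2)
  linear_combination ((r:ℂ)^(-z) * 2^z * G1 * G2⁻¹ * 2 * (z/2 + j) * Complex.Gamma (z/2)) * hPP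

lemma gfun_differentiableAt (n : ℕ) (s ν r : ℝ) (hs : 0 < s) (hr : 0 < r) (j : ℕ) (z : ℂ)
    (hz : z.re < 2*s*ν + n) (hz1 : -2 * (j:ℝ) - 2 < z.re) (h : ∀ k < j, z/2 + k ≠ 0) :
    DifferentiableAt ℂ (gfun n s ν r j) z := by
  have hr' : (r:ℂ) ≠ 0 := by exact_mod_cast hr.ne'
  have d1 : DifferentiableAt ℂ (fun z : ℂ => (r:ℂ) ^ (-z)) z :=
    DifferentiableAt.const_cpow (by fun_prop) (Or.inl hr')
  have d2 : DifferentiableAt ℂ (fun z : ℂ => (2:ℂ) ^ z) z :=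
    DifferentiableAt.const_cpow (by fun_prop) (Or.inl two_ne_zero)
  have d3 : DifferentiableAt ℂ (fun z : ℂ => Complex.Gamma ((ν:ℂ) + ((n:ℂ) - z)/(2*(s:ℂ)))) z := by
    refine DifferentiableAt.comp (f := fun z : ℂ => (ν:ℂ) + ((n:ℂ) - z)/(2*(s:ℂ))) z (Complex.differentiableAt_Gamma _ fun m h => ?_) (by fun_prop)
    have := congrArg Complex.re h
    have e : ((ν:ℂ) + ((n:ℂ) - z)/(2*(s:ℂ))).re = ν + (n - z.re)/(2*s) := by
      rw [show (2*(s:ℂ)) = ((2*s:ℝ):ℂ) by push_cast; ring, Complex.add_re, Complex.div_ofReal_re]; simp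
    rw [e] at this
    have h0 : 0 < (2 * s * ν + n - z.re) / (2*s) := by apply div_pos <;> linarith
    have e : (2 * s * ν + n - z.re) / (2*s) = ν + (n - z.re)/(2*s) := by field_simp; ring
    simp at this
    have : (0:ℝ) ≤ m := by positivity
    linarith
  have d4 : DifferentiableAt ℂ (fun z : ℂ => (Complex.Gamma (((n:ℂ) - z)/2))⁻¹) z := 
    DifferentiableAt.comp (f := fun z : ℂ => ((n:ℂ) - z)/2) z (Complex.differentiable_one_div_Gamma _) (by fun_prop)
  have d5 : DifferentiableAt ℂ (fun z : ℂ => 2 * Complex.Gamma (z/2 + j + 1)) z := by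
    refine DifferentiableAt.const_mul ?_ _
    refine DifferentiableAt.comp (f := fun z : ℂ => z/2 + j + 1) z (Complex.differentiableAt_Gamma _ fun m h => ?_) (by fun_prop)
    have h2 : z = -2 * m - 2 * j - 2 := by linear_combination 2 * h
    have := congrArg Complex.re h2
    simp at this
    have : (0:ℝ) ≤ m := by positivity
    linarith
  have hp : ∏ k ∈ Finset.range j, (z/2 + k) ≠ 0 :=
    Finset.prod_ne_zero_iff.mpr fun k hk => h k (Finset.mem_range.mp hk)
  have d6 : DifferentiableAt ℂ (fun z : ℂ => (∏ k ∈ Finset.range j, (z/2 + (k:ℂ)))⁻¹) z := by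
    refine DifferentiableAt.inv ?_ hp
    exact DifferentiableAt.fun_finsetProd fun k _ => by fun_prop
  exact ((((d1.mul d2).mul d3).mul d4).mul d5).mul d6

lemma gfun_pole (n : ℕ) (s ν r : ℝ) (hs : 0 < s) (hr : 0 < r) (j : ℕ) :
    gfun n s ν r j ((-2 * (j:ℝ) : ℝ) : ℂ) = 2 * ((Real.Gamma (ν + (n:ℝ)/(2*s) + (j:ℝ)/s) /
            (Real.Gamma ((n:ℝ)/2 + (j:ℝ)) * (j.factorial : ℝ)) * (-(r^2)/4)^j : ℝ) : ℂ) := by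
  have hr' : (r:ℂ) ≠ 0 := by exact_mod_cast hr.ne'
  have hs' : (s:ℂ) ≠ 0 := by exact_mod_cast hs.ne'
  have e1 : (r:ℂ) ^ (-((-2 * (j:ℝ) : ℝ) : ℂ)) = (r:ℂ)^(2*j) := by
    rw [← Complex.cpow_natCast]; congr 1; push_cast; ring
  have e2 : (2:ℂ) ^ (((-2 * (j:ℝ) : ℝ) : ℂ)) = ((2:ℂ)^(2*j))⁻¹ := by
    rw [← Complex.cpow_natCast, ← Complex.cpow_neg]; congr 1; push_cast; ring
  have e3 : (ν:ℂ) + ((n:ℂ) - ((-2 * (j:ℝ) : ℝ) : ℂ))/(2*(s:ℂ)) = ((ν + (n:ℝ)/(2*s) + (j:ℝ)/s : ℝ) : ℂ) := by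
    push_cast; field_simp; ring
  have e4 : ((n:ℂ) - ((-2 * (j:ℝ) : ℝ) : ℂ))/2 = (((n:ℝ)/2 + (j:ℝ) : ℝ) : ℂ) := by
    push_cast; ring
  have e5 : ((-2 * (j:ℝ) : ℝ) : ℂ)/2 + j + 1 = 1 := by push_cast; ring
  have e6 : ∏ k ∈ Finset.range j, (((-2 * (j:ℝ) : ℝ) : ℂ)/2 + k) = (-1)^j * (j.factorial : ℂ) := by
    rw [← prod_neg]
    refine Finset.prod_congr rfl fun k _ => ?_
    push_cast; ring
  have e7 : (-(r:ℂ)^2/4)^j = (-1)^j * ((r:ℂ)^(2*j) * ((2:ℂ)^(2*j))⁻¹) := by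
    rw [pow_mul, pow_mul, ← inv_pow, ← mul_pow, ← mul_pow]
    congr 1; norm_num; ring
  have e8 : ((-1:ℂ)^j)⁻¹ = (-1)^j := by rw [← inv_pow]; norm_num
  rw [gfun, e1, e2, e3, e4, e5, e6, Complex.Gamma_ofReal, Complex.Gamma_ofReal, Complex.Gamma_one]
  push_cast
  rw [e7, mul_inv, e8]
  ring

lemma ffun_step (n : ℕ) (s ν r : ℝ) (hs : 0 < s) (hr : 0 < r) (hν : 0 < 2*s*ν + n) (j : ℕ) (lo hi : ℝ)
    (h1 : -2 * (j:ℝ) - 2 < lo) (h2 : lo < -2 * (j:ℝ)) (h3 : -2 * (j:ℝ) < hi)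
    (h4 : hi < 2*s*ν + n) (h5 : ∀ k : ℕ, k < j → hi < -2 * (k:ℝ)) :
    (∫ y : ℝ, ffun n s ν r (hi + y * Complex.I)) - (∫ y : ℝ, ffun n s ν r (lo + y * Complex.I))
      = 2 * Real.pi * (2 * ((Real.Gamma (ν + (n:ℝ)/(2*s) + (j:ℝ)/s) /
            (Real.Gamma ((n:ℝ)/2 + (j:ℝ)) * (j.factorial : ℝ)) * (-(r^2)/4)^j : ℝ) : ℂ)) := by
  rw [← gfun_pole n s ν r hs hr j]
  set p : ℝ := -2 * (j:ℝ) with hp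
  obtain ⟨C, -, hC⟩ := ffun_bound n s ν r hs hr lo hi h4
  have ne_of : ∀ z : ℂ, ∀ t : ℝ, z.re < t → z ≠ t := by
    intro z t h h0; rw [h0] at h; simp at h
  -- the open strip
  set hi' : ℝ := if j = 0 then 2*s*ν + n else -2 * (j:ℝ) + 2 with hhi'
  have hi1 : hi < hi' := by
    rw [hhi']; split_ifs with h
    · exact h4
    · have := h5 (j-1) (by omega)
      rw [Nat.cast_sub (by omega)] at this
      push_cast at this; linarith
  have hi2 : hi' ≤ 2*s*ν + n := by
    rw [hhi']; split_ifs with h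
    · exact le_rfl
    · have : (1:ℝ) ≤ j := by exact_mod_cast Nat.one_le_iff_ne_zero.mpr h
      linarith
  have hi3 : ∀ k : ℕ, k < j → hi' ≤ -2 * (k:ℝ) := by
    intro k hk
    rw [hhi', if_neg (by omega)]
    have : (k:ℝ) + 1 ≤ j := by exact_mod_cast hk
    linarith
  have hUo : IsOpen {z : ℂ | -2 * (j:ℝ) - 2 < z.re ∧ z.re < hi'} :=
    (isOpen_lt continuous_const Complex.continuous_re).inter (isOpen_lt Complex.continuous_re continuous_const)
  have hk0 : ∀ z : ℂ, z.re < hi' → ∀ k < j, z/2 + (k:ℂ) ≠ 0 := by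
    intro z hz k hk h0
    have h6 : z = -2 * k := by linear_combination 2 * h0
    have := congrArg Complex.re h6
    simp at this
    have := hi3 k hk
    linarith
  have hG : DifferentiableOn ℂ (gfun n s ν r j) {z : ℂ | -2 * (j:ℝ) - 2 < z.re ∧ z.re < hi'} := by
    intro z hz
    exact (gfun_differentiableAt n s ν r hs hr j z (by linarith [hz.2]) hz.1 (hk0 z hz.2)).differentiableWithinAt
  have hU : {z : ℂ | -2 * (j:ℝ) - 2 < z.re ∧ z.re < hi'} ∈ nhds (p : ℂ) := by
    refine hUo.mem_nhds ⟨?_, ?_⟩ <;> rw [Complex.ofReal_re] <;> linarith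
  have hD := (Complex.differentiableOn_dslope hU).mpr hG
  have hint1 : ∀ m : ℕ, hi ≠ -2 * m := by
    intro m h
    rcases lt_or_ge m j with hm | hm
    · have := h5 m hm; linarith
    · have : (j:ℝ) ≤ m := by exact_mod_cast hm
      linarith
  have hint2 : ∀ m : ℕ, lo ≠ -2 * m := by
    intro m h
    rcases le_or_gt m j with hm | hm
    · have : (m:ℝ) ≤ j := by exact_mod_cast hm
      linarith
    · have : (j:ℝ) + 1 ≤ m := by exact_mod_cast hm
      linarith
  have key := strip_shift (ffun n s ν r) (dslope (gfun n s ν r j) p) (gfun n s ν r j p) p (hi - p) (p - lo) C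
    (by linarith) (by linarith)
    (hD.mono (by
      rintro z ⟨hz1, hz2⟩
      constructor <;> linarith))
    (by
      intro z hz1 hz2 hzp
      rw [dslope_of_ne _ hzp, slope_def_field]
      have hzp' : z - p ≠ 0 := sub_ne_zero.mpr hzp
      rw [gfun_eq n s ν r j z (hk0 z (by linarith)) (by intro h; apply hzp; rw [h, hp]; push_cast; ring)]
      have : z + 2 * j = z - p := by rw [hp]; push_cast; ring
      rw [this]
      field_simp
      ring)
    (by
      intro x y hx1 hx2 hy
      exact hC x y (by linarith) (by linarith) hy)
  have e1 : p + (hi - p) = hi := by ring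
  have e2 : p - (p - lo) = lo := by ring
  rw [e1, e2] at key
  exact key (ffun_integrable n s ν r hs hr hi h4 hint1) (ffun_integrable n s ν r hs hr lo (by linarith) hint2)

lemma ffun_far (n : ℕ) (hn : 1 ≤ n) (s ν r : ℝ) (hs : 1/2 < s) (hr : 0 < r) (hν : 0 < 2*s*ν + n) :
    Filter.Tendsto (fun N : ℕ => ∫ y : ℝ, ffun n s ν r ((-1 - 2 * (N:ℝ) : ℝ) + y * Complex.I))
      Filter.atTop (nhds 0) := by
  have hs0 : 0 < s := by linarith
  have hn' : (1:ℝ) ≤ n := by exact_mod_cast hn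
  set X0 : ℝ := ν + (n + 1)/(2*s) with hX0
  have hX0p : 0 < X0 := by
    have : X0 = (2*s*ν + n + 1)/(2*s) := by rw [hX0]; field_simp; ring
    rw [this]; apply div_pos <;> linarith
  set m : ℝ := min (X0^2) ((1/(2*s))^2) with hm
  have hmp : 0 < m := lt_min (by positivity) (by positivity)
  have hsum := summable_fw (X0 + 2) (3/2) ((n:ℝ)/2 + 1/2) (1/s) ((r/2)^2) (by linarith) (by norm_num)
    (by positivity) (by positivity) (by rw [div_lt_iff₀ hs0]; linarith) (by positivity)
  have hz := (hsum.tendsto_atTop_zero).mul_const ((r/2) * Real.pi * (m⁻¹ * Real.pi))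
  rw [zero_mul] at hz
  refine squeeze_zero_norm (fun N => ?_) hz
  set E : ℝ := Real.Gamma (X0 + 2 + N * (1/s)) / (Real.Gamma (3/2 + N) * Real.Gamma ((n:ℝ)/2 + 1/2 + N)) * ((r/2)^2)^N with hE
  have hN0 : (0:ℝ) ≤ N := by positivity
  have gp1 : 0 < Real.Gamma (X0 + 2 + N * (1/s)) := Real.Gamma_pos_of_pos (by positivity)
  have gp2 : 0 < Real.Gamma (3/2 + N) := Real.Gamma_pos_of_pos (by positivity)
  have gp3 : 0 < Real.Gamma ((n:ℝ)/2 + 1/2 + N) := Real.Gamma_pos_of_pos (by positivity)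
  have hE0 : 0 ≤ E := by positivity
  have hb : ∀ y : ℝ, ‖ffun n s ν r ((-1 - 2 * (N:ℝ) : ℝ) + y * Complex.I)‖ ≤ E * (r/2) * Real.pi * m⁻¹ * (1 + y^2)⁻¹ := by
    intro y
    set x : ℝ := -1 - 2 * (N:ℝ) with hx
    have hsin := norm_sin_sq (Real.pi * (x/2)) (Real.pi * (y/2))
    have hs1 : Real.sin (Real.pi * (x/2)) ^ 2 = 1 := by
      have : Real.cos (Real.pi * (x/2)) = 0 := by
        rw [Real.cos_eq_zero_iff]
        refine ⟨-(N:ℤ) - 1, ?_⟩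
        rw [hx]; push_cast; ring
      have h := Real.sin_sq_add_cos_sq (Real.pi * (x/2))
      rw [this] at h; linarith
    have hch := Real.cosh_sq (Real.pi * (y/2))
    have hcp := Real.cosh_pos (Real.pi * (y/2))
    set S := ‖Complex.sin ((Real.pi * (x/2) : ℝ) + (Real.pi * (y/2) : ℝ) * Complex.I)‖ with hS
    set H := Real.cosh (Real.pi * (y/2)) with hH
    have hSH : S = H := by
      refine (sq_eq_sq₀ (norm_nonneg _) hcp.le).mp ?_
      rw [hsin, hs1, hch]; ring
    have hSp : 0 < S := by rw [hSH]; exact hcp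
    have hcosh : Real.cosh (Real.pi * (-y/2)) = H := by
      rw [hH, ← Real.cosh_neg]; congr 1; ring
    have g1 := gamma_lower (1 - x/2) (-y/2) (by rw [hx]; linarith)
    have g2 := gamma_lower ((n-x)/2) (-y/2) (by rw [hx]; linarith)
    have hX : 0 < ν + (n-x)/(2*s) := by
      have : ν + (n-x)/(2*s) = X0 + N * (1/s) := by rw [hX0, hx]; field_simp; ring
      rw [this]; positivity
    have g3 := gamma_upper2 (ν + (n-x)/(2*s)) (-y/(2*s)) hX
    rw [ffun_norm n s ν r hr x y (norm_pos_iff.mp hSp), ← hS, hSH]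
    rw [hcosh] at g1 g2
    have a1 : 1 - x/2 = 3/2 + N := by rw [hx]; ring
    have a2 : (n-x)/2 = (n:ℝ)/2 + 1/2 + N := by rw [hx]; ring
    have a3 : ν + (n-x)/(2*s) = X0 + N * (1/s) := by rw [hX0, hx]; field_simp; ring
    rw [a1] at g1 ⊢
    rw [a2] at g2 ⊢
    rw [a3] at g3 ⊢
    rw [show X0 + N * (1/s) + 2 = X0 + 2 + N * (1/s) by ring] at g3
    have hden : m * (1 + y^2) ≤ (X0 + N * (1/s))^2 + (-y/(2*s))^2 := by
      have h1 : m ≤ X0^2 := min_le_left _ _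
      have h2 : m ≤ (1/(2*s))^2 := min_le_right _ _
      have h3 : X0^2 ≤ (X0 + N * (1/s))^2 := by
        have : 0 ≤ N * (1/s) := by positivity
        gcongr; linarith
      have h4 : (-y/(2*s))^2 = (1/(2*s))^2 * y^2 := by ring
      rw [h4]
      nlinarith [sq_nonneg y]
    have g3' := g3.trans (div_le_div_of_nonneg_left gp1.le (by positivity) hden)
    have hpow : r ^ (-x) * 2 ^ x = ((r/2)^2)^N * (r/2) := by
      rw [show (2:ℝ)^x = ((2:ℝ)^(-x))⁻¹ by rw [← Real.rpow_neg (by norm_num), neg_neg], ← div_eq_mul_inv,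
        ← Real.div_rpow hr.le (by norm_num), ← pow_mul, ← pow_succ, ← Real.rpow_natCast]
      congr 1; rw [hx]; push_cast; ring
    rw [hpow]
    have hqq : Real.sqrt H * Real.sqrt H = H := Real.mul_self_sqrt hcp.le
    calc _ ≤ ((r/2)^2)^N * (r/2) * (Real.Gamma (X0 + 2 + N * (1/s)) / (m * (1+y^2))) * (Real.pi / H) *
          (Real.sqrt H / Real.Gamma (3/2 + N)) * (Real.sqrt H / Real.Gamma ((n:ℝ)/2 + 1/2 + N)) := by
          gcongr
      _ = ((r/2)^2)^N * (r/2) * (Real.Gamma (X0 + 2 + N * (1/s)) / (m * (1+y^2))) * (Real.pi / H) *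
          ((Real.sqrt H * Real.sqrt H) / (Real.Gamma (3/2 + N) * Real.Gamma ((n:ℝ)/2 + 1/2 + N))) := by ring
      _ = _ := by
          rw [hqq, hE]; field_simp
  calc _ ≤ ∫ y : ℝ, E * (r/2) * Real.pi * m⁻¹ * (1 + y^2)⁻¹ :=
        norm_integral_le_of_norm_le (integrable_inv_one_add_sq.const_mul _) (Filter.Eventually.of_forall hb)
    _ = _ := by rw [integral_const_mul, integral_univ_inv_one_add_sq]; ring

theorem inverse_mellin_eigenfunction_subcritical
    (n : ℕ) (hn : 1 ≤ n) (s : ℝ) (hs : s ∈ Set.Ioc (1/2 : ℝ) 1) (ν : ℝ)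
    (hν : -((n:ℝ)/(2*s)) < ν) (σ : ℝ) (hσ1 : 0 < σ) (hσ2 : σ < s*ν + (n:ℝ)/2)
    (u : ℂ → ℂ)
    (hu : ∀ z : ℂ, u z = 2 ^ z * Complex.Gamma ((ν:ℂ) + ((n:ℂ) - z)/(2*(s:ℂ))) *
        Complex.Gamma (z/2) / Complex.Gamma (((n:ℂ) - z)/2))
    (r : ℝ) (hr : 0 < r) :
    Integrable (fun lam : ℝ =>
      (r:ℂ) ^ (-(2*(σ:ℂ) + (lam:ℂ)*Complex.I)) * u (2*(σ:ℂ) + (lam:ℂ)*Complex.I)) ∧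
    Summable (fun j : ℕ =>
      |Real.Gamma (ν + (n:ℝ)/(2*s) + (j:ℝ)/s) /
        (Real.Gamma ((n:ℝ)/2 + (j:ℝ)) * (j.factorial : ℝ)) * (-(r^2)/4)^j|) ∧
    (1/(2*(Real.pi:ℂ))) * (∫ lam : ℝ,
        (r:ℂ) ^ (-(2*(σ:ℂ) + (lam:ℂ)*Complex.I)) * u (2*(σ:ℂ) + (lam:ℂ)*Complex.I))
      = 2 * ∑' j : ℕ,
          ((Real.Gamma (ν + (n:ℝ)/(2*s) + (j:ℝ)/s) /
            (Real.Gamma ((n:ℝ)/2 + (j:ℝ)) * (j.factorial : ℝ)) * (-(r^2)/4)^j : ℝ) : ℂ) := by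
  obtain ⟨hs1, hs2⟩ := hs
  have hs0 : 0 < s := by linarith
  have hn' : (1:ℝ) ≤ n := by exact_mod_cast hn
  have hσ3 : 2 * σ < 2*s*ν + n := by linarith
  have hpos : 0 < 2*s*ν + n := by linarith
  have e0 : (fun lam : ℝ =>
      (r:ℂ) ^ (-(2*(σ:ℂ) + (lam:ℂ)*Complex.I)) * u (2*(σ:ℂ) + (lam:ℂ)*Complex.I))
      = fun lam : ℝ => ffun n s ν r ((2 * σ : ℝ) + lam * Complex.I) := by
    funext lam
    rw [hu, ffun]; push_cast; rfl
  rw [e0]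
  set T : ℕ → ℝ := fun j => Real.Gamma (ν + (n:ℝ)/(2*s) + (j:ℝ)/s) /
        (Real.Gamma ((n:ℝ)/2 + (j:ℝ)) * (j.factorial : ℝ)) * (-(r^2)/4)^j with hT
  have ha : 0 < ν + (n:ℝ)/(2*s) := by linarith
  have hsum : Summable (fun j : ℕ => |T j|) := by
    have h := summable_fw (ν + (n:ℝ)/(2*s)) ((n:ℝ)/2) 1 (1/s) (r^2/4) ha
      (by positivity) (by positivity) (by positivity) (by rw [div_lt_iff₀ hs0]; linarith) (by positivity)
    refine h.congr fun j => ?_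
    have g1 : 0 < Real.Gamma (ν + (n:ℝ)/(2*s) + (j:ℝ)/s) := Real.Gamma_pos_of_pos (by positivity)
    have g2 : 0 < Real.Gamma ((n:ℝ)/2 + (j:ℝ)) := Real.Gamma_pos_of_pos (by positivity)
    rw [hT]
    simp only
    rw [abs_mul, abs_pow, abs_div, abs_mul, abs_of_pos g1, abs_of_pos g2, Nat.abs_cast, neg_div, abs_neg,
      abs_of_pos (show 0 < r^2/4 by positivity), add_comm (1:ℝ) (j:ℝ), Real.Gamma_nat_eq_factorial, mul_one_div]
  refine ⟨?_, hsum, ?_⟩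
  · refine ffun_integrable n s ν r hs0 hr _ hσ3 fun m h => ?_
    have : (0:ℝ) ≤ m := by positivity
    linarith
  have hsumT : Summable T := hsum.of_abs
  have hfin : ∀ N : ℕ, (∫ y : ℝ, ffun n s ν r ((2*σ : ℝ) + y * Complex.I)) =
      2 * Real.pi * (2 * ((∑ j ∈ Finset.range (N+1), T j : ℝ) : ℂ)) +
        ∫ y : ℝ, ffun n s ν r ((-1 - 2 * (N:ℝ) : ℝ) + y * Complex.I) := by
    intro N
    induction N with
    | zero =>
      have h := ffun_step n s ν r hs0 hr hpos 0 (-1 - 2 * ((0:ℕ):ℝ)) (2*σ) (by norm_num) (by norm_num) (by simpa using hσ1) hσ3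
        (by intro k hk; omega)
      rw [zero_add, Finset.sum_range_one, ← sub_eq_iff_eq_add]
      exact h
    | succ N ih =>
      have hN : (0:ℝ) ≤ N := by positivity
      have h := ffun_step n s ν r hs0 hr hpos (N+1) (-1 - 2 * ((N+1:ℕ):ℝ)) (-1 - 2 * (N:ℝ))
        (by linarith) (by linarith) (by push_cast; linarith) (by linarith)
        (by
          intro k hk
          have : (k:ℝ) ≤ N := by exact_mod_cast Nat.lt_succ_iff.mp hk
          linarith)
      rw [sub_eq_iff_eq_add] at h
      rw [ih, h, Finset.sum_range_succ T (N+1)]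
      push_cast [hT]
      ring
  have hlim1 : Filter.Tendsto (fun N : ℕ => 2 * Real.pi * (2 * ((∑ j ∈ Finset.range (N+1), T j : ℝ) : ℂ)) +
        ∫ y : ℝ, ffun n s ν r ((-1 - 2 * (N:ℝ) : ℝ) + y * Complex.I)) Filter.atTop
        (nhds (2 * Real.pi * (2 * ((∑' j, T j : ℝ) : ℂ)) + 0)) := by
    refine Filter.Tendsto.add ?_ (ffun_far n hn s ν r hs1 hr hpos)
    refine Filter.Tendsto.const_mul _ (Filter.Tendsto.const_mul _ ?_)
    exact (Complex.continuous_ofReal.tendsto _).comp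
      (hsumT.hasSum.tendsto_sum_nat.comp (Filter.tendsto_add_atTop_nat 1))
  have hlim2 : Filter.Tendsto (fun _ : ℕ => (∫ y : ℝ, ffun n s ν r ((2*σ : ℝ) + y * Complex.I))) Filter.atTop
      (nhds (∫ y : ℝ, ffun n s ν r ((2*σ : ℝ) + y * Complex.I))) := tendsto_const_nhds
  have hfe : (fun _ : ℕ => (∫ y : ℝ, ffun n s ν r ((2*σ : ℝ) + y * Complex.I))) = _ := funext hfin
  rw [hfe] at hlim2
  rw [tendsto_nhds_unique hlim2 hlim1, add_zero, ← Complex.ofReal_tsum]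
  have hpi : (Real.pi : ℂ) ≠ 0 := by exact_mod_cast Real.pi_ne_zero
  change 1 / (2 * (Real.pi:ℂ)) * (2 * Real.pi * (2 * ((∑' j, T j : ℝ) : ℂ))) = 2 * ((∑' j, T j : ℝ) : ℂ)
  generalize ((∑' j, T j : ℝ) : ℂ) = Q
  field_simp
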